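/- Fix any ρ ∈ [0,1], any feasible profile (D_el, H_el), and any data model 𝔇. There exists a feasible profile (D_pfx, H_pfx), depending only on (D_el, H_el), such that for every countable language collection ℒ, every randomized generator 𝒜 that satisfies (i) for every K ∈ ℒ and every X ∈ 𝔇(K), almost surely liminf_{i→∞} μ^pfx_i(𝒜(X),K,D_pfx) ≥ ρ, and (ii) sup_{K∈ℒ} sup_{X∈𝔇(K)} H_𝒜^{ℒ,K,X}(t) ≤ H_pfx(t) for all sufficiently large t, also satisfies: for every K ∈ ℒ and every X ∈ 𝔇(K), almost surely liminf_{i→∞} μ^el_i(𝒜(X),K,D_el) ≥ ρ, and sup_{K∈ℒ} sup_{X∈𝔇(K)} H_𝒜^{ℒ,K,X}(t) ≤ H_el(t) for all sufficiently large t. -/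

import Mathlib

open MeasureTheory Filter
open scoped Classical

noncomputable section

/-- The output `o_t` (for `t ≥ 1`) of a generator with next-output function `g`
on the input sequence `X` (indexed from 1): `o_t = g [x_1, …, x_t]`. -/
def outSeq (g : List ℕ → ℕ) (X : ℕ → ℕ) (t : ℕ) : ℕ :=
  g ((List.range t).map fun s => X (s + 1))

/-- The output prefix set `𝒜(X)_t = {o_1, …, o_t}`. -/
def outUpTo (g : List ℕ → ℕ) (X : ℕ → ℕ) (t : ℕ) : Finset ℕ :=
  (Finset.Icc 1 t).image (outSeq g X)

/-- The observed strings `{x_1, …, x_t}`. -/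
def obsUpTo (X : ℕ → ℕ) (t : ℕ) : Finset ℕ :=
  (Finset.Icc 1 t).image X

/-- Validity constraint on a generator: each output is a fresh string, i.e.
`o_t ∉ {x_1,…,x_t} ∪ {o_1,…,o_{t−1}}`. -/
def ValidGen (g : List ℕ → ℕ) : Prop :=
  ∀ (X : ℕ → ℕ) (t : ℕ), 1 ≤ t →
    (∀ s, 1 ≤ s → s ≤ t → outSeq g X t ≠ X s) ∧
    (∀ s, 1 ≤ s → s < t → outSeq g X t ≠ outSeq g X s)

/-- A randomized generator: a probability space `(Ω, P)` of seeds together with a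
measurable family of deterministic (valid) generators. -/
structure RandGen where
  Ω : Type
  mΩ : MeasurableSpace Ω
  P : @Measure Ω mΩ
  prob : @IsProbabilityMeasure Ω mΩ P
  gen : Ω → List ℕ → ℕ
  valid : ∀ ω, ValidGen (gen ω)
  meas : ∀ l : List ℕ, @Measurable Ω ℕ mΩ inferInstance (fun ω => gen ω l)

/-- `k_j`: the `j`-th smallest element of `K` (for `j ≥ 1`). -/
def nthElem (K : Set ℕ) (j : ℕ) : ℕ := Nat.nth (· ∈ K) (j - 1)

/-- `K_i = {k_1, …, k_i}`: the `i` smallest elements of `K`. -/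
def prefixSet (K : Set ℕ) (i : ℕ) : Finset ℕ := (Finset.Icc 1 i).image (nthElem K)

/-- Timely element-wise density `μ^el_i(𝒜(X), K, D)`. -/
def muEl (g : List ℕ → ℕ) (X : ℕ → ℕ) (K : Set ℕ) (D : ℕ → ℕ) (i : ℕ) : ℝ :=
  (∑ j ∈ Finset.Icc 1 i, if nthElem K j ∈ outUpTo g X (D j) then (1 : ℝ) else 0) / i

/-- Prefix-wise density `μ^pfx_i(𝒜(X), K, D) = |𝒜(X)_{D(i)} ∩ K_i| / i`. -/
def muPfx (g : List ℕ → ℕ) (X : ℕ → ℕ) (K : Set ℕ) (D : ℕ → ℕ) (i : ℕ) : ℝ :=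
  ((outUpTo g X (D i) ∩ prefixSet K i).card : ℝ) / i

/-- The number of hallucinations `|𝒜(X)_t \ K|` of a deterministic generator. -/
def hallucCount (g : List ℕ → ℕ) (X : ℕ → ℕ) (K : Set ℕ) (t : ℕ) : ℕ :=
  ((outUpTo g X t).filter fun n => n ∉ K).card

/-- The hallucination rate `H_𝒜^{ℒ,K,X}(t) = 𝔼[|𝒜(X)_t \ K| / t]`,
the expectation being over the internal randomness (the seed). -/
def hallucRate (A : RandGen) (X : ℕ → ℕ) (K : Set ℕ) (t : ℕ) : ℝ :=
  ∫ ω, (hallucCount (A.gen ω) X K t : ℝ) / t ∂A.P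

/-- `E ∈ ℰ(K)`: a total enumeration (with possible repetitions) of `K`. -/
def IsEnumOf (E : ℕ → ℕ) (K : Set ℕ) : Prop :=
  (∀ t, 1 ≤ t → E t ∈ K) ∧ ∀ k ∈ K, ∃ t, 1 ≤ t ∧ E t = k

/-- A countable collection of languages (infinite sets of strings). -/
def IsLangCollection (L : Set (Set ℕ)) : Prop :=
  L.Countable ∧ ∀ K ∈ L, K.Infinite

/-- Generalized inverse `D⁻¹(t) = min {n ≥ 1 : D(n) ≥ t}`. -/
def Dinv (D : ℕ → ℕ) (t : ℕ) : ℕ := sInf {n | 1 ≤ n ∧ t ≤ D n}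

/-- A feasible profile `(D, H)`: `D` is a monotone nondecreasing, discrete convex
(`D(m+1) − D(m) ≥ D(m) − D(m−1)`), superlinear deadline function, and `H` is a
nonnegative monotone nonincreasing vanishing function with `t·H(t)/D⁻¹(t) → ∞`. -/
def FeasibleProfile (D : ℕ → ℕ) (H : ℕ → ℝ) : Prop :=
  (∀ i, 1 ≤ i → 1 ≤ D i) ∧
  (∀ m n, 1 ≤ m → m ≤ n → D m ≤ D n) ∧
  (∀ m, 2 ≤ m → D m + D m ≤ D (m + 1) + D (m - 1)) ∧
  Tendsto (fun i : ℕ => (D i : ℝ) / i) atTop atTop ∧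
  (∀ t, 0 ≤ H t) ∧
  (∀ s t, 1 ≤ s → s ≤ t → H t ≤ H s) ∧
  Tendsto H atTop (nhds 0) ∧
  Tendsto (fun t : ℕ => (t : ℝ) * H t / (Dinv D t : ℝ)) atTop atTop


/-- Every real sequence tending to infinity dominates a positive integer sequence that
tends to infinity. -/
theorem exists_slower_nat_seq (f : ℕ → ℝ) (hf : Tendsto f atTop atTop) :
    ∃ M : ℕ → ℕ, (∀ t, 1 ≤ M t) ∧ Tendsto M atTop atTop ∧
      Tendsto (fun t => f t / (M t : ℝ)) atTop atTop := by
  have hs : Tendsto (fun t => √(f t)) atTop atTop := Real.tendsto_sqrt_atTop.comp hf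
  refine ⟨fun t => ⌊√(f t)⌋₊ + 1, fun t => Nat.le_add_left 1 _, ?_, ?_⟩
  · exact tendsto_atTop_mono (fun t => Nat.le_succ _) (tendsto_nat_floor_atTop.comp hs)
  · refine tendsto_atTop_mono' atTop ?_ (hs.atTop_div_const (show (0 : ℝ) < 2 by norm_num))
    filter_upwards [hs.eventually_ge_atTop 1] with t ht
    have hfl := Nat.floor_le (Real.sqrt_nonneg (f t))
    have hpos : 0 < f t := Real.sqrt_pos.mp (by linarith)
    have hsq := Real.mul_self_sqrt hpos.le
    rw [div_le_div_iff₀ (by norm_num) (by positivity)]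
    push_cast
    nlinarith

/-- The generalized inverse of an unbounded deadline function is attained. -/
theorem Dinv_spec {D : ℕ → ℕ} (hD : Tendsto (fun i : ℕ => (D i : ℝ) / i) atTop atTop) (t : ℕ) :
    1 ≤ Dinv D t ∧ t ≤ D (Dinv D t) := by
  have hne : {n | 1 ≤ n ∧ t ≤ D n}.Nonempty := by
    obtain ⟨n, hn, hn1⟩ := ((hD.eventually_ge_atTop (t : ℝ)).and (eventually_ge_atTop 1)).exists
    refine ⟨n, hn1, ?_⟩
    have h1 : (1 : ℝ) ≤ n := by exact_mod_cast hn1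
    rw [le_div_iff₀ (by linarith)] at hn
    have : (t : ℝ) ≤ D n := by nlinarith [(Nat.cast_nonneg t : (0 : ℝ) ≤ t)]
    exact_mod_cast this
  exact Nat.sInf_mem hne

theorem lt_Dinv {D : ℕ → ℕ} (hmono : ∀ m n, 1 ≤ m → m ≤ n → D m ≤ D n)
    (hD : Tendsto (fun i : ℕ => (D i : ℝ) / i) atTop atTop) {n t : ℕ} (h : D n < t) :
    n < Dinv D t := by
  obtain ⟨h1, h2⟩ := Dinv_spec hD t
  by_contra! hle
  have := hmono _ _ h1 hle
  omega

theorem tendsto_Dinv {D : ℕ → ℕ} (hmono : ∀ m n, 1 ≤ m → m ≤ n → D m ≤ D n)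
    (hD : Tendsto (fun i : ℕ => (D i : ℝ) / i) atTop atTop) :
    Tendsto (Dinv D) atTop atTop := by
  refine tendsto_atTop.mpr fun n => ?_
  filter_upwards [eventually_gt_atTop (D n)] with t ht
  exact (lt_Dinv hmono hD ht).le

/-- For a discrete convex `D`, the slopes `(D k - D 1) / k` are nondecreasing. -/
theorem slope_mono {D : ℕ → ℕ} (hmono : ∀ m n, 1 ≤ m → m ≤ n → D m ≤ D n)
    (hconv : ∀ m, 2 ≤ m → D m + D m ≤ D (m + 1) + D (m - 1)) {k x : ℕ} (hk : 1 ≤ k)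
    (hkx : k ≤ x) : (D k - D 1) * x ≤ k * (D x - D 1) := by
  have hcast : ∀ m, 1 ≤ m → ((D m - D 1 : ℕ) : ℤ) = D m - D 1 := fun m hm =>
    Nat.cast_sub (hmono 1 m le_rfl hm)
  have hinc : ∀ m, 1 ≤ m → (D m : ℤ) - D 1 ≤ (m - 1) * (D (m + 1) - D m) := by
    intro m hm
    induction m, hm using Nat.le_induction with
    | base => simp
    | succ m hm ih =>
      have hc := hconv (m + 1) (by omega)
      simp only [Nat.add_sub_cancel] at hc
      zify at hc
      have hm0 : (0 : ℤ) ≤ m := by positivity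
      push_cast
      nlinarith
  induction x, hkx using Nat.le_induction with
  | base => rw [mul_comm]
  | succ x hx ih =>
    have hx1 : 1 ≤ x := hk.trans hx
    have hi := hinc x hx1
    have hm := hmono x (x + 1) hx1 (by omega)
    zify at ih hm ⊢
    rw [hcast k hk, hcast x hx1] at ih
    rw [hcast k hk, hcast (x + 1) (by omega)]
    have hx0 : (0 : ℤ) < x := by exact_mod_cast hx1
    have hk0 : (0 : ℤ) < k := by exact_mod_cast hk
    have hstep : ((D x : ℤ) - D 1) * (x + 1) ≤ x * (D (x + 1) - D 1) := by nlinarith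
    have h1 : x * (((D k : ℤ) - D 1) * (x + 1)) ≤ x * (k * (D (x + 1) - D 1)) := by
      calc x * (((D k : ℤ) - D 1) * (x + 1)) = (((D k : ℤ) - D 1) * x) * (x + 1) := by ring
        _ ≤ (k * (D x - D 1)) * (x + 1) := by gcongr
        _ = k * (((D x : ℤ) - D 1) * (x + 1)) := by ring
        _ ≤ k * (x * (D (x + 1) - D 1)) := by gcongr
        _ = x * (k * (D (x + 1) - D 1)) := by ring
    exact le_of_mul_le_mul_left h1 hx0

/-- A superlinear convex deadline function `D` admits a superlinear convex `D'` with
`D' n ≤ D (o(n))` whose generalized inverse exceeds that of `D` by an arbitrarily slowly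
growing factor only. -/
theorem exists_slower_deadline (D : ℕ → ℕ) (hpos : ∀ i, 1 ≤ i → 1 ≤ D i)
    (hmono : ∀ m n, 1 ≤ m → m ≤ n → D m ≤ D n)
    (hconv : ∀ m, 2 ≤ m → D m + D m ≤ D (m + 1) + D (m - 1))
    (hD : Tendsto (fun i : ℕ => (D i : ℝ) / i) atTop atTop)
    (r : ℕ → ℝ) (hr : Tendsto r atTop atTop) :
    ∃ D' M : ℕ → ℕ,
      (∀ i, 1 ≤ i → 1 ≤ D' i) ∧
      (∀ m n, 1 ≤ m → m ≤ n → D' m ≤ D' n) ∧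
      (∀ m, 2 ≤ m → D' m + D' m ≤ D' (m + 1) + D' (m - 1)) ∧
      Tendsto (fun i : ℕ => (D' i : ℝ) / i) atTop atTop ∧
      (∀ B : ℕ, ∀ᶠ n in atTop, ∀ x, n ≤ B * x → D' n ≤ D x) ∧
      Tendsto (fun t => r t / (M t : ℝ)) atTop atTop ∧
      ∀ᶠ t in atTop, Dinv D' t ≤ 3 * (M t * Dinv D t) := by
  have hE : Tendsto (fun i : ℕ => ((D i - D 1 : ℕ) : ℝ) / i) atTop atTop := by
    refine tendsto_atTop_mono' atTop ?_ (tendsto_atTop_add_const_right _ (-(D 1 : ℝ)) hD)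
    filter_upwards [eventually_ge_atTop 1] with i hi
    rw [Nat.cast_sub (hmono 1 i le_rfl hi), sub_div]
    have h1 : (1 : ℝ) ≤ i := by exact_mod_cast hi
    have := div_le_self (Nat.cast_nonneg (α := ℝ) (D 1)) h1
    linarith
  have hEinv := hE.comp (tendsto_Dinv hmono hD)
  have hmin : Tendsto (fun t => min (((D (Dinv D t) - D 1 : ℕ) : ℝ) / Dinv D t) (r t))
      atTop atTop := by
    refine tendsto_atTop.mpr fun b => ?_
    filter_upwards [hEinv.eventually_ge_atTop b, hr.eventually_ge_atTop b] with t h1 h2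
    exact le_min h1 h2
  obtain ⟨M, hM1, hM, hfM⟩ := exists_slower_nat_seq _ hmin
  set k : ℕ → ℕ := Dinv D with hk
  have hk1 : ∀ t, 1 ≤ k t := fun t => (Dinv_spec hD t).1
  have hMpos : ∀ t, (0 : ℝ) < M t := fun t => by exact_mod_cast hM1 t
  have hrM : Tendsto (fun t => r t / (M t : ℝ)) atTop atTop :=
    tendsto_atTop_mono (fun t => div_le_div_of_nonneg_right (min_le_right _ _) (hMpos t).le) hfM
  set a : ℕ → ℕ := fun t => (D (k t) - D 1) / (M t * k t) with ha
  have haM : ∀ t, a t * (M t * k t) ≤ D (k t) - D 1 := fun t => Nat.div_mul_le_self _ _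
  have hat : Tendsto a atTop atTop := by
    refine tendsto_atTop.mpr fun b => ?_
    filter_upwards [hfM.eventually_ge_atTop (b : ℝ)] with t ht
    have hkt : (0 : ℝ) < k t := by exact_mod_cast hk1 t
    rw [le_div_iff₀ (hMpos t)] at ht
    have h2 := ht.trans (min_le_left _ _)
    rw [le_div_iff₀ hkt] at h2
    rw [ha]
    rw [Nat.le_div_iff_mul_le (Nat.mul_pos (hM1 t) (hk1 t)), ← mul_assoc]
    exact_mod_cast h2
  set p : ℕ → ℕ → ℕ := fun t n => a t * (n - M t * k t) with hp
  set S : ℕ → ℕ := fun n => (Finset.range (D n + 1)).sup fun t => p t n with hS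
  have hpS : ∀ t n, p t n ≤ S n := by
    intro t n
    by_cases h : D n < t
    · have h1 : n < k t := lt_Dinv hmono hD h
      have h2 : n - M t * k t = 0 := by
        have := Nat.mul_le_mul_right (k t) (hM1 t)
        omega
      simp [hp, h2]
    · exact Finset.le_sup (f := fun t => p t n) (Finset.mem_range.mpr (by omega))
  have hSp : ∀ n, ∃ t, S n = p t n := by
    intro n
    obtain ⟨t, -, ht⟩ := Finset.exists_mem_eq_sup (Finset.range (D n + 1)) ⟨0, by simp⟩
      (fun t => p t n)
    exact ⟨t, ht⟩
  have hSmono : ∀ m n, m ≤ n → S m ≤ S n := by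
    intro m n hmn
    obtain ⟨t, ht⟩ := hSp m
    rw [ht]
    exact (Nat.mul_le_mul_left _ (by omega)).trans (hpS t n)
  have hsup : ∀ t n, p t n ≤ D 1 + S n := fun t n => (hpS t n).trans (by omega)
  refine ⟨fun n => D 1 + S n, M, fun i _ => (hpos 1 le_rfl).trans (Nat.le_add_right _ _),
    fun m n _ hmn => Nat.add_le_add_left (hSmono m n hmn) _, ?_, ?_, ?_, hrM, ?_⟩
  · intro m hm
    obtain ⟨t, ht⟩ := hSp m
    have h1 := hpS t (m + 1)
    have h2 := hpS t (m - 1)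
    have h3 : p t m + p t m ≤ p t (m + 1) + p t (m - 1) := by
      simp only [hp, ← mul_add]
      exact Nat.mul_le_mul_left _ (by omega)
    simp only
    omega
  · refine tendsto_atTop.mpr fun b => ?_
    obtain ⟨c, hc⟩ := exists_nat_ge b
    obtain ⟨t, ht⟩ := (hat.eventually_ge_atTop (c + 1)).exists
    filter_upwards [eventually_ge_atTop ((c + 1) * (M t * k t) + 1)] with n hn
    have hn0 : (0 : ℝ) < n := by exact_mod_cast (by omega : 0 < n)
    rw [le_div_iff₀ hn0]
    have h1 : c * n ≤ D 1 + S n := by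
      refine le_trans ?_ (hsup t n)
      refine le_trans ?_ (Nat.mul_le_mul_right _ ht)
      rw [Nat.mul_sub, add_mul c 1 n]
      omega
    calc b * n ≤ c * n := by gcongr
      _ ≤ _ := by exact_mod_cast h1
  · intro B
    obtain ⟨T, hT⟩ := (hM.eventually_ge_atTop B).exists_forall_of_atTop
    set A := (Finset.range T).sup a with hA
    obtain ⟨N, hN⟩ := (hE.eventually_ge_atTop ((A * B : ℕ) : ℝ)).exists_forall_of_atTop
    filter_upwards [eventually_gt_atTop (B * (N + 1))] with n hn x hx
    have hxN : N + 1 < x := lt_of_mul_lt_mul_left (hn.trans_le hx) (Nat.zero_le B)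
    have hx1 : 1 ≤ x := by omega
    obtain ⟨t, ht⟩ := hSp n
    have hgoal : p t n ≤ D x - D 1 := by
      by_cases hn0 : n ≤ M t * k t
      · simp [hp, Nat.sub_eq_zero_of_le hn0]
      have hpn : p t n ≤ a t * (B * x) := Nat.mul_le_mul_left _ ((Nat.sub_le _ _).trans hx)
      refine hpn.trans ?_
      by_cases htT : t < T
      · have h1 : a t ≤ A := Finset.le_sup (f := a) (Finset.mem_range.mpr htT)
        have h2 := hN x (by omega)
        have hx0 : (0 : ℝ) < x := by exact_mod_cast hx1
        rw [le_div_iff₀ hx0] at h2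
        have h3 : A * B * x ≤ D x - D 1 := by exact_mod_cast h2
        rw [← mul_assoc]
        exact (Nat.mul_le_mul_right _ (Nat.mul_le_mul_right _ h1)).trans h3
      · have hBM : B ≤ M t := hT t (by omega)
        have hkx : k t ≤ x := by
          by_contra! hlt
          have := Nat.mul_le_mul hBM hlt.le
          omega
        have h1 := slope_mono hmono hconv (hk1 t) hkx
        refine le_of_mul_le_mul_left ?_ (hk1 t)
        calc k t * (a t * (B * x)) = a t * (B * k t) * x := by ring
          _ ≤ a t * (M t * k t) * x := by gcongr
          _ ≤ (D (k t) - D 1) * x := Nat.mul_le_mul_right _ (haM t)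
          _ ≤ _ := h1
    have := hmono 1 x le_rfl hx1
    omega
  · filter_upwards [hat.eventually_ge_atTop 1] with t ht
    have hMk : 0 < M t * k t := Nat.mul_pos (hM1 t) (hk1 t)
    refine Nat.sInf_le ⟨by omega, ?_⟩
    have h1 := hpS t (3 * (M t * k t))
    have h2 : D (k t) - D 1 < (a t + 1) * (M t * k t) := by
      rw [mul_comm]
      exact Nat.lt_mul_div_succ _ hMk
    have h3 : p t (3 * (M t * k t)) = 2 * (a t * (M t * k t)) := by
      have : 3 * (M t * k t) - M t * k t = 2 * (M t * k t) := by omega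
      simp only [hp, this]
      ring
    have h4 : M t * k t ≤ a t * (M t * k t) := Nat.le_mul_of_pos_left _ ht
    have h5 := (Dinv_spec hD t).2
    rw [add_mul, one_mul] at h2
    rw [← hk] at h5
    simp only
    omega

theorem outUpTo_mono (g : List ℕ → ℕ) (X : ℕ → ℕ) {s t : ℕ} (h : s ≤ t) :
    outUpTo g X s ⊆ outUpTo g X t :=
  Finset.image_subset_image (Finset.Icc_subset_Icc_right h)

/-- If `D' i` does not exceed `D j` whenever `i ≤ B * j`, then the prefix-wise density under
`D'` exceeds the element-wise density under `D` by at most `1 / B`. -/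
theorem muPfx_le_muEl_add (g : List ℕ → ℕ) (X : ℕ → ℕ) (K : Set ℕ) {D D' : ℕ → ℕ} {B i : ℕ}
    (hB : 1 ≤ B) (hi : 1 ≤ i) (h : ∀ j, i ≤ B * j → D' i ≤ D j) :
    muPfx g X K D' i ≤ muEl g X K D i + 1 / B := by
  set F := (Finset.Icc 1 i).filter fun j => nthElem K j ∈ outUpTo g X (D j)
  have hsub : outUpTo g X (D' i) ∩ prefixSet K i ⊆
      (F ∪ Finset.Icc 1 (i / B)).image (nthElem K) := by
    intro y hy
    rw [Finset.mem_inter, prefixSet, Finset.mem_image] at hy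
    obtain ⟨hy, j, hj, rfl⟩ := hy
    refine Finset.mem_image_of_mem _ (Finset.mem_union.mpr ?_)
    rcases le_total i (B * j) with hle | hle
    · exact Or.inl (Finset.mem_filter.mpr ⟨hj, outUpTo_mono g X (h j hle) hy⟩)
    · refine Or.inr (Finset.mem_Icc.mpr ⟨(Finset.mem_Icc.mp hj).1, ?_⟩)
      rwa [Nat.le_div_iff_mul_le hB, mul_comm]
  have hcard : (outUpTo g X (D' i) ∩ prefixSet K i).card ≤ F.card + i / B := by
    refine (Finset.card_le_card hsub).trans (Finset.card_image_le.trans ?_)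
    simpa using Finset.card_union_le F (Finset.Icc 1 (i / B))
  have hi0 : (0 : ℝ) < i := by exact_mod_cast hi
  have hB0 : (0 : ℝ) < B := by exact_mod_cast hB
  have hsum : (∑ j ∈ Finset.Icc 1 i, if nthElem K j ∈ outUpTo g X (D j) then (1 : ℝ) else 0)
      = F.card := by
    rw [Finset.sum_boole]
  rw [muPfx, muEl, hsum, div_add' _ _ _ hi0.ne']
  refine div_le_div_of_nonneg_right ?_ hi0.le
  have h1 : ((i / B : ℕ) : ℝ) ≤ 1 / B * i := by
    rw [one_div, inv_mul_eq_div]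
    exact Nat.cast_div_le
  have h2 : ((outUpTo g X (D' i) ∩ prefixSet K i).card : ℝ) ≤ F.card + (i / B : ℕ) := by
    exact_mod_cast hcard
  linarith

theorem muEl_le_one (g : List ℕ → ℕ) (X : ℕ → ℕ) (K : Set ℕ) (D : ℕ → ℕ) (i : ℕ) :
    muEl g X K D i ≤ 1 := by
  rw [muEl, Finset.sum_boole]
  refine div_le_one_of_le₀ ?_ (Nat.cast_nonneg i)
  have := Finset.card_filter_le (Finset.Icc 1 i) fun j => nthElem K j ∈ outUpTo g X (D j)
  rw [Nat.card_Icc, Nat.add_sub_cancel] at this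
  exact_mod_cast this

theorem le_liminf_muEl (g : List ℕ → ℕ) (X : ℕ → ℕ) (K : Set ℕ) {D D' : ℕ → ℕ}
    (h : ∀ B : ℕ, ∀ᶠ n in atTop, ∀ x, n ≤ B * x → D' n ≤ D x) {ρ : ℝ}
    (hρ : ρ ≤ liminf (fun i => muPfx g X K D' i) atTop) :
    ρ ≤ liminf (fun i => muEl g X K D i) atTop := by
  refine le_of_forall_pos_sub_le fun ε hε => ?_
  obtain ⟨n, hn⟩ := exists_nat_one_div_lt (half_pos hε)
  have hbdd : IsBoundedUnder (· ≥ ·) atTop fun i => muPfx g X K D' i :=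
    isBoundedUnder_of ⟨0, fun i => by unfold muPfx; positivity⟩
  have hlt : ρ - ε / 2 < liminf (fun i => muPfx g X K D' i) atTop := by linarith
  have hco : IsCoboundedUnder (· ≥ ·) atTop fun i => muEl g X K D i :=
    (isBoundedUnder_of ⟨1, muEl_le_one g X K D⟩).isCoboundedUnder_ge
  refine le_liminf_of_le hco ?_
  filter_upwards [eventually_lt_of_lt_liminf hlt hbdd, h (n + 1), eventually_ge_atTop 1]
    with i h1 h2 hi
  have h3 := muPfx_le_muEl_add g X K (by omega) hi h2
  push_cast at h3
  linarith

/-- **Reduction Between Density Metrics** (general data models).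
Given a feasible profile `(D_el, H_el)` there is a feasible profile `(D_pfx, H_pfx)`,
depending only on `(D_el, H_el)`, such that for any `ρ ∈ [0,1]`, any data model `𝔇`,
any countable collection `ℒ`, and any randomized generator `𝒜`: if `𝒜` achieves
prefix-wise density `ρ` almost surely under `D_pfx` and hallucination rate at most
`H_pfx` eventually, then it achieves element-wise density `ρ` almost surely under
`D_el` and hallucination rate at most `H_el` eventually. -/
theorem stmt4 (Del : ℕ → ℕ) (Hel : ℕ → ℝ) (hel : FeasibleProfile Del Hel) :
    ∃ Dp : ℕ → ℕ, ∃ Hp : ℕ → ℝ, FeasibleProfile Dp Hp ∧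
      ∀ ρ : ℝ, 0 ≤ ρ → ρ ≤ 1 →
      ∀ 𝔇 : Set ℕ → Set (ℕ → ℕ),
      ∀ L : Set (Set ℕ), IsLangCollection L →
      ∀ A : RandGen,
        ((∀ K ∈ L, ∀ X ∈ 𝔇 K,
            ∀ᵐ ω ∂A.P, ρ ≤ liminf (fun i => muPfx (A.gen ω) X K Dp i) atTop) ∧
         (∃ T, ∀ t, T ≤ t → ∀ K ∈ L, ∀ X ∈ 𝔇 K, hallucRate A X K t ≤ Hp t)) →
        ((∀ K ∈ L, ∀ X ∈ 𝔇 K,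
            ∀ᵐ ω ∂A.P, ρ ≤ liminf (fun i => muEl (A.gen ω) X K Del i) atTop) ∧
         (∃ T, ∀ t, T ≤ t → ∀ K ∈ L, ∀ X ∈ 𝔇 K, hallucRate A X K t ≤ Hel t)) := by
  obtain ⟨hpos, hmono, hconv, hD, hH0, hHanti, hH, hr⟩ := hel
  obtain ⟨D', M, hpos', hmono', hconv', hD', hle, hrM, hinv⟩ :=
    exists_slower_deadline Del hpos hmono hconv hD _ hr
  refine ⟨D', Hel, ⟨hpos', hmono', hconv', hD', hH0, hHanti, hH, ?_⟩, ?_⟩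
  · refine tendsto_atTop_mono' atTop ?_ (hrM.atTop_div_const (show (0 : ℝ) < 3 by norm_num))
    filter_upwards [hinv] with t ht
    have h1 : (0 : ℝ) < Dinv D' t := by exact_mod_cast (Dinv_spec hD' t).1
    have h2 : (Dinv D' t : ℝ) ≤ 3 * (M t * Dinv Del t) := by exact_mod_cast ht
    rw [div_div, div_div]
    refine div_le_div_of_nonneg_left (mul_nonneg (Nat.cast_nonneg t) (hH0 t)) h1 (h2.trans_eq ?_)
    ring
  · rintro ρ - - 𝔇 L - A ⟨hdens, hrate⟩
    refine ⟨fun K hK X hX => ?_, hrate⟩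
    filter_upwards [hdens K hK X hX] with ω hω
    exact le_liminf_muEl (A.gen ω) X K hle hω

end
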